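/- For every positive integer n and all positive integers m and h with m ≤ n, the minimum size of an h-fold signed sumset equals the minimum size of an h-fold sumset in the cyclic group ℤ_n: ρ±(ℤ_n, m, h) = ρ(ℤ_n, m, h). -/

import Mathlib

open Finset Pointwise

/-- The `h`-fold sumset of a finite subset `A` of an abelian group:
`hA = {Σ λ_a • a : λ : A → ℕ, Σ λ_a = h}`. -/
def foldSumset {G : Type*} [AddCommGroup G] (h : ℕ) (A : Finset G) : Set G :=
  {g | ∃ c : G → ℕ, (∑ a ∈ A, c a) = h ∧ (∑ a ∈ A, c a • a) = g}

/-- The `h`-fold signed sumset of a finite subset `A` of an abelian group: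
`h±A = {Σ λ_a • a : λ : A → ℤ, Σ |λ_a| = h}`. -/
def foldSignedSumset {G : Type*} [AddCommGroup G] (h : ℕ) (A : Finset G) : Set G :=
  {g | ∃ c : G → ℤ, (∑ a ∈ A, (c a).natAbs) = h ∧ (∑ a ∈ A, c a • a) = g}

/-- `ρ(G, m, h) = min {|hA| : A ⊆ G, |A| = m}`. -/
noncomputable def rho (G : Type*) [AddCommGroup G] (m h : ℕ) : ℕ :=
  sInf {k | ∃ A : Finset G, A.card = m ∧ (foldSumset h A).ncard = k}

/-- `ρ±(G, m, h) = min {|h±A| : A ⊆ G, |A| = m}`. -/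
noncomputable def rhoPM (G : Type*) [AddCommGroup G] (m h : ℕ) : ℕ :=
  sInf {k | ∃ A : Finset G, A.card = m ∧ (foldSignedSumset h A).ncard = k}

/-- `f_d(m, h) = (h⌈m/d⌉ - h + 1) d`. -/
def fdmh (d m h : ℕ) : ℕ := (h * ((m + d - 1) / d) - h + 1) * d

/-- `u(n, m, h) = min {f_d(m, h) : d a positive divisor of n}`. -/
noncomputable def uFun (n m h : ℕ) : ℕ :=
  sInf {k | ∃ d : ℕ, 0 < d ∧ d ∣ n ∧ k = fdmh d m h}

theorem exists_addSubgroup_card_add_le {G : Type*} [AddCommGroup G] [Fintype G] [DecidableEq G]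
    (A : Finset G) (hA : A ≠ univ) :
    ∃ (H : AddSubgroup G) (K : Finset G), (∀ x, x ∈ K ↔ x ∈ H) ∧ K + A ≠ univ ∧
      ∀ X : Finset G, X.Nonempty → X + A ≠ univ → #X + #(K + A) ≤ #(X + A) + #K := by
  set δ : Finset G → ℤ := fun X => (#(X + A) : ℤ) - #X with hδ
  set S : Finset (Finset G) := univ.filter fun X => X.Nonempty ∧ X + A ≠ univ with hS
  have hSmem : ∀ X, X ∈ S ↔ X.Nonempty ∧ X + A ≠ univ := by simp [hS]
  have hSne : S.Nonempty := ⟨0, by rw [hSmem, zero_add]; exact ⟨zero_nonempty, hA⟩⟩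
  obtain ⟨X₁, hX₁, hmin₁⟩ := exists_min_image S δ hSne
  obtain ⟨X, hX, hmin⟩ := exists_min_image (S.filter fun Y => δ Y = δ X₁) card
    ⟨X₁, by simp [hX₁]⟩
  rw [mem_filter, hSmem] at hX
  obtain ⟨⟨hXne, hXA⟩, hXδ⟩ := hX
  have hle : ∀ Y : Finset G, Y.Nonempty → Y + A ≠ univ → δ X ≤ δ Y := fun Y h1 h2 =>
    hXδ ▸ hmin₁ Y ((hSmem Y).2 ⟨h1, h2⟩)
  have hcard : ∀ Y : Finset G, Y.Nonempty → Y + A ≠ univ → δ Y ≤ δ X → #X ≤ #Y :=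
    fun Y h1 h2 h3 => hmin Y (by
      rw [mem_filter, hSmem]
      exact ⟨⟨h1, h2⟩, by rw [← hXδ]; exact le_antisymm h3 (hle Y h1 h2)⟩)
  have hdual : #X + #(X + A) ≤ Fintype.card G := by
    have hsub : -(X + A)ᶜ + A ⊆ -Xᶜ := by
      intro y hy
      obtain ⟨z, hz, a, ha, rfl⟩ := mem_add.1 hy
      rw [mem_neg', mem_compl] at hz ⊢
      intro hx
      exact hz (mem_add.2 ⟨_, hx, a, ha, by abel⟩)
    have h1 := card_le_card hsub
    have h2 : #(-(X + A)ᶜ) = Fintype.card G - #(X + A) := by rw [card_neg, card_compl]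
    rw [card_neg, card_compl] at h1
    have h3 := card_le_univ X
    have h4 := card_le_univ (X + A)
    have h5 := hXne.card_pos
    have := hcard (-(X + A)ᶜ)
      (by simpa [nonempty_iff_ne_empty, compl_eq_empty_iff] using hXA)
      (by
        intro h
        rw [h, card_univ] at h1
        omega)
      (by simp only [hδ]; omega)
    omega
  have htrans : ∀ t : G, (X ∩ (t +ᵥ X)).Nonempty → t +ᵥ X = X := by
    intro t ht
    by_contra hne
    set Y := t +ᵥ X with hY
    have hYc : #Y = #X := card_vadd_finset t X
    have hYA : #(Y + A) = #(X + A) := by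
      rw [hY, vadd_add_assoc, card_vadd_finset]
    have hlt : #(X ∩ Y) < #X := by
      apply card_lt_card
      refine ⟨inter_subset_left, fun h => hne ?_⟩
      exact (eq_of_subset_of_card_le (fun x hx => (mem_inter.1 (h hx)).2) hYc.le).symm
    have h1 : (X ∩ Y) + A ≠ univ := fun h => hXA (univ_subset_iff.1 (h ▸ add_subset_add_right inter_subset_left))
    have h2 : δ X < δ (X ∩ Y) := by
      by_contra h
      have := hcard _ ht h1 (not_lt.1 h)
      omega
    have h3 : #((X ∪ Y) + A) + #((X ∩ Y) + A) ≤ #(X + A) + #(Y + A) := by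
      rw [union_add, ← card_union_add_card_inter (X + A)]
      exact Nat.add_le_add_left (card_le_card inter_add_subset) _
    have h4 := card_union_add_card_inter X Y
    have h5 : (X ∪ Y) + A = univ := by
      by_contra h
      have := hle _ (hXne.mono subset_union_left) h
      simp only [hδ] at this h2
      omega
    have h6 := ht.card_pos
    rw [h5, card_univ] at h3
    simp only [hδ] at h2
    omega
  obtain ⟨x₀, hx₀⟩ := hXne
  refine ⟨AddAction.stabilizer G X, -x₀ +ᵥ X, fun x => ?_, ?_, fun Y h1 h2 => ?_⟩
  · rw [AddAction.mem_stabilizer_iff, mem_vadd_finset]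
    constructor
    · rintro ⟨y, hy, rfl⟩
      refine htrans _ ⟨y, mem_inter.2 ⟨hy, mem_vadd_finset.2 ⟨x₀, hx₀, ?_⟩⟩⟩
      simp only [vadd_eq_add]; abel
    · intro h
      refine ⟨x + x₀, ?_, by simp only [vadd_eq_add]; abel⟩
      rw [← h]
      exact mem_vadd_finset.2 ⟨x₀, hx₀, rfl⟩
  · rw [vadd_add_assoc]
    intro h
    apply hXA
    apply eq_univ_of_card
    rw [← card_univ, ← h, card_vadd_finset]
  · rw [vadd_add_assoc, card_vadd_finset, card_vadd_finset]
    have := hle Y h1 h2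
    simp only [hδ] at this
    omega

theorem card_dvd_card_add_of_addSubgroup {G : Type*} [AddCommGroup G] [DecidableEq G]
    {H : AddSubgroup G} {K : Finset G} (hK : ∀ x, x ∈ K ↔ x ∈ H) (A : Finset G) :
    #K ∣ #(K + A) := by
  refine card_dvd_card_add_left ?_
  rintro _ ⟨a, ha, rfl⟩ _ ⟨b, hb, rfl⟩ hne
  change Disjoint (K.image (· + a)) (K.image (· + b))
  rw [Finset.disjoint_left]
  intro x hx hx'
  obtain ⟨k, hk, rfl⟩ := mem_image.1 hx
  obtain ⟨l, hl, hkl⟩ := mem_image.1 hx'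
  rw [hK] at hk hl
  have hab : a - b ∈ H := by
    have : a - b = l - k := by
      rw [sub_eq_sub_iff_add_eq_add, add_comm a k]; exact hkl.symm
    rw [this]; exact H.sub_mem hl hk
  apply hne
  ext z
  simp only [mem_image, hK]
  constructor
  · rintro ⟨w, hw, rfl⟩
    exact ⟨w + (a - b), H.add_mem hw hab, by abel⟩
  · rintro ⟨w, hw, rfl⟩
    exact ⟨w - (a - b), H.sub_mem hw hab, by abel⟩

theorem card_nsmul_add_ge {G : Type*} [AddCommGroup G] [Fintype G] [DecidableEq G]
    {A K : Finset G} (hA : A.Nonempty) (hK : K.Nonempty) {δ : ℕ}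
    (h : ∀ X : Finset G, X.Nonempty → X + A ≠ univ → #X + δ ≤ #(X + A)) (j : ℕ)
    (hj : j • A + K ≠ univ) : j * δ + #K ≤ #(j • A + K) := by
  induction j with
  | zero => simp
  | succ j ih =>
    have heq : (j + 1) • A + K = (j • A + K) + A := by rw [succ_nsmul, add_right_comm]
    rw [heq] at hj ⊢
    have h1 := h _ ((hA.nsmul).add hK) hj
    have h2 := ih fun hu => hj (by
      rw [hu]
      exact eq_univ_of_card _ (le_antisymm (card_le_univ _) (card_le_card_add_right hA)))
    rw [add_mul, one_mul]
    omega

/-- Two fibres of total size more than `|K|` over cosets of `K` have a full sumset. -/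
theorem mem_add_of_card_fibres {G : Type*} [AddCommGroup G] [DecidableEq G]
    {H : AddSubgroup G} {K : Finset G} (hK : ∀ x, x ∈ K ↔ x ∈ H) {A : Finset G} {b x z : G}
    (hcard : #K < #{a ∈ A | a - b ∈ K} + #{a ∈ A | a - x ∈ K}) (hz : z - (b + x) ∈ K) :
    z ∈ A + A := by
  by_contra hzA
  set P := {a ∈ A | a - b ∈ K} with hP
  set Q := {a ∈ A | a - x ∈ K} with hQ
  have hdisj : Disjoint P (Q.image (z - ·)) := by
    rw [Finset.disjoint_left]
    intro p hp hq
    obtain ⟨q, hqQ, rfl⟩ := mem_image.1 hq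
    exact hzA (mem_add.2 ⟨z - q, (mem_filter.1 hp).1, q, (mem_filter.1 hqQ).1, by abel⟩)
  have hsub : P ∪ Q.image (z - ·) ⊆ K.image (· + b) := by
    refine union_subset (fun p hp => ?_) (fun p hp => ?_)
    · exact mem_image.2 ⟨p - b, (mem_filter.1 hp).2, by abel⟩
    · obtain ⟨q, hq, rfl⟩ := mem_image.1 hp
      refine mem_image.2 ⟨z - q - b, ?_, by abel⟩
      have h1 := (mem_filter.1 hq).2
      rw [hK] at hz h1 ⊢
      have : z - q - b = (z - (b + x)) - (q - x) := by abel
      rw [this]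
      exact H.sub_mem hz h1
  have h1 := card_le_card hsub
  rw [card_union_of_disjoint hdisj, card_image_of_injective _ (sub_right_injective),
    card_image_of_injective _ (add_left_injective b)] at h1
  omega

theorem card_fibres_of_ne {G : Type*} [AddCommGroup G] [DecidableEq G]
    {H : AddSubgroup G} {K : Finset G} (hK : ∀ x, x ∈ K ↔ x ∈ H) {A : Finset G}
    (hcard : #(K + A) + 1 ≤ #A + #K) {b x : G} (hb : b ∈ A) (hx : x ∈ A) (hbx : b - x ∉ K) :
    #K < #{a ∈ A | a - b ∈ K} + #{a ∈ A | a - x ∈ K} := by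
  have hsub : K.image (· + b) ∪ K.image (· + x) ⊆ K + A := by
    refine union_subset (fun p hp => ?_) (fun p hp => ?_) <;>
    · obtain ⟨k, hk, rfl⟩ := mem_image.1 hp
      exact add_mem_add hk (by assumption)
  have hdisj : Disjoint (K.image (· + b)) (K.image (· + x)) := by
    rw [Finset.disjoint_left]
    intro p hp hq
    obtain ⟨k, hk, rfl⟩ := mem_image.1 hp
    obtain ⟨l, hl, h⟩ := mem_image.1 hq
    apply hbx
    rw [hK] at hk hl ⊢
    have : b - x = l - k := by
      rw [sub_eq_sub_iff_add_eq_add, add_comm b k]; exact h.symm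
    rw [this]
    exact H.sub_mem hl hk
  have hA : A ⊆ ((K + A) \ (K.image (· + b) ∪ K.image (· + x))) ∪
      ({a ∈ A | a - b ∈ K} ∪ {a ∈ A | a - x ∈ K}) := by
    intro a ha
    by_cases h1 : a - b ∈ K
    · simp [ha, h1]
    by_cases h2 : a - x ∈ K
    · simp [ha, h2]
    refine mem_union_left _ (mem_sdiff.2 ⟨?_, ?_⟩)
    · exact mem_add.2 ⟨0, (hK 0).2 H.zero_mem, a, ha, zero_add a⟩
    · rw [mem_union, mem_image, mem_image]
      rintro (⟨k, hk, rfl⟩ | ⟨k, hk, rfl⟩)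
      · exact h1 (by simpa using hk)
      · exact h2 (by simpa using hk)
  have h1 := (card_le_card hA).trans (card_union_le _ _)
  have h2 := card_union_le {a ∈ A | a - b ∈ K} {a ∈ A | a - x ∈ K}
  have h3 := card_le_card hsub
  rw [card_sdiff_of_subset hsub] at h1
  rw [card_union_of_disjoint hdisj, card_image_of_injective _ (add_left_injective b),
    card_image_of_injective _ (add_left_injective x)] at h1 h3
  omega

theorem mem_nsmul_cases {G : Type*} [AddCommGroup G] [DecidableEq G]
    {H : AddSubgroup G} (A : Finset G) (c : G) (j : ℕ) {s : G} (hs : s ∈ (j + 1) • A) :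
    s - (j + 1) • c ∈ H ∨ ∃ b ∈ A, b - c ∉ H ∧ s - b ∈ j • A := by
  induction j generalizing s with
  | zero =>
    rw [zero_add, one_nsmul] at hs
    by_cases h : s - c ∈ H
    · left; simpa using h
    · right; exact ⟨s, hs, h, by simp⟩
  | succ j ih =>
    rw [succ_nsmul] at hs
    obtain ⟨t, ht, a, ha, rfl⟩ := mem_add.1 hs
    by_cases h : a - c ∈ H
    · rcases ih ht with h1 | ⟨b, hb, hbc, hsb⟩
      · left
        have : t + a - (j + 1 + 1) • c = (t - (j + 1) • c) + (a - c) := by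
          rw [succ_nsmul c (j + 1)]; abel
        rw [this]
        exact H.add_mem h1 h
      · right
        refine ⟨b, hb, hbc, ?_⟩
        rw [succ_nsmul]
        exact mem_add.2 ⟨t - b, hsb, a, ha, by abel⟩
    · right
      exact ⟨a, ha, h, by simpa using ht⟩

theorem exists_dvd_card_nsmul_ge (N : ℕ) : ∀ {G : Type*} [AddCommGroup G] [Fintype G]
    [DecidableEq G], Fintype.card G = N → ∀ {A : Finset G}, A.Nonempty → ∀ {j : ℕ}, 1 ≤ j →
    ∃ d q : ℕ, 0 < d ∧ d ∣ N ∧ #A ≤ (q + 1) * d ∧ ((j + 1) * q + 1) * d ≤ #((j + 1) • A) := by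
  induction N using Nat.strong_induction_on with
  | _ N IH =>
  intro G _ _ _ hN A hA j hj
  have huniv : (j + 1) • A = univ → ∃ d q : ℕ, 0 < d ∧ d ∣ N ∧ #A ≤ (q + 1) * d ∧
      ((j + 1) * q + 1) * d ≤ #((j + 1) • A) := fun h =>
    ⟨N, 0, hN ▸ Fintype.card_pos, dvd_rfl, by simpa [hN] using card_le_univ A, by simp [h, hN]⟩
  by_cases hAu : A = univ
  · apply huniv
    apply eq_univ_of_card
    refine le_antisymm (card_le_univ _) ?_
    rw [succ_nsmul, ← card_univ, ← hAu]
    exact card_le_card_add_left hA.nsmul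
  obtain ⟨H, K, hK, hKA, hmin⟩ := exists_addSubgroup_card_add_le A hAu
  have h0K : (0 : G) ∈ K := (hK 0).2 H.zero_mem
  have hKne : K.Nonempty := ⟨0, h0K⟩
  obtain ⟨δ, hδ⟩ := Nat.exists_eq_add_of_le (card_le_card_add_right (s := K) hA)
  have hmin' : ∀ X : Finset G, X.Nonempty → X + A ≠ univ → #X + δ ≤ #(X + A) := fun X h1 h2 => by
    have := hmin X h1 h2
    omega
  have hcardA : #(K + A) + 1 ≤ #A + #K := by
    have := hmin 0 zero_nonempty (by rwa [zero_add])
    rw [zero_add, card_zero] at this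
    omega
  have hdvd : #K ∣ δ := by
    have := card_dvd_card_add_of_addSubgroup hK A
    rw [hδ] at this
    exact (Nat.dvd_add_right dvd_rfl).1 this
  let _ : Fintype H := Fintype.subtype K hK
  have hKcard : Fintype.card H = #K := Fintype.card_of_subtype K hK
  have hKN : #K ∣ N := by
    rw [← hKcard, ← hN, ← Nat.card_eq_fintype_card, ← Nat.card_eq_fintype_card]
    exact H.card_addSubgroup_dvd_card
  have hchain := card_nsmul_add_ge hA hKne hmin'
  by_cases hper : (j + 1) • A + K ⊆ (j + 1) • A
  · by_cases hu : (j + 1) • A = univ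
    · exact huniv hu
    have hsub : (j + 1) • A ⊆ (j + 1) • A + K := subset_add_left _ h0K
    have h1 := hchain (j + 1) (by rwa [hper.antisymm hsub])
    rw [hper.antisymm hsub] at h1
    obtain ⟨q, rfl⟩ := hdvd
    refine ⟨#K, q, hKne.card_pos, hKN, ?_, ?_⟩
    · have h2 : #A ≤ #(K + A) := card_le_card_add_left hKne
      linarith
    · linarith
  obtain ⟨y, hy, hyA⟩ := not_subset.1 hper
  obtain ⟨c, hc, hcmin⟩ := exists_min_image A (fun b => #{a ∈ A | a - b ∈ K}) hA
  have hfib : ∀ b ∈ A, b - c ∉ K → ∀ x ∈ A,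
      #K < #{a ∈ A | a - b ∈ K} + #{a ∈ A | a - x ∈ K} := by
    intro b hb hbc x hx
    by_cases hbx : b - x ∈ K
    · have heq : ({a ∈ A | a - x ∈ K} : Finset G) = {a ∈ A | a - b ∈ K} := by
        refine filter_congr fun a _ => ?_
        rw [hK] at hbx
        rw [hK, hK]
        have : a - x = (a - b) + (b - x) := by abel
        rw [this]
        exact H.add_mem_cancel_right hbx
      have h1 := card_fibres_of_ne hK hcardA hb hc hbc
      have h2 := hcmin b hb
      rw [heq]
      omega
    · exact card_fibres_of_ne hK hcardA hb hx hbx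
  have hfull : ∀ b ∈ A, b - c ∉ K → ∀ z, z - b ∈ j • A + K → z ∈ (j + 1) • A := by
    intro b hb hbc z hz
    obtain ⟨i, rfl⟩ := Nat.exists_eq_add_of_le' hj
    obtain ⟨s, hs, η, hη, hz⟩ := mem_add.1 hz
    rw [succ_nsmul] at hs
    obtain ⟨t, ht, x, hx, rfl⟩ := mem_add.1 hs
    have h1 : z - t ∈ A + A := by
      refine mem_add_of_card_fibres hK (hfib b hb hbc x hx) ?_
      have : z - t - (b + x) = η := by
        have : z = t + x + η + b := by rw [hz]; abel
        rw [this]; abel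
      rwa [this]
    rw [succ_nsmul, succ_nsmul, add_assoc]
    exact mem_add.2 ⟨t, ht, _, h1, by abel⟩
  have hcosub : K.image (· + c) ⊆ K + A := by
    intro p hp
    obtain ⟨k, hk, rfl⟩ := mem_image.1 hp
    exact add_mem_add hk hc
  have hDcard : #((K + A) \ K.image (· + c)) = δ := by
    rw [card_sdiff_of_subset hcosub, card_image_of_injective _ (add_left_injective c), hδ]
    omega
  have hDmem : ∀ z ∈ (K + A) \ K.image (· + c), ∃ η ∈ K, ∃ b ∈ A, b - c ∉ K ∧ η + b = z := by
    intro z hz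
    rw [mem_sdiff] at hz
    obtain ⟨η, hη, b, hb, rfl⟩ := mem_add.1 hz.1
    refine ⟨η, hη, b, hb, fun hbc => hz.2 (mem_image.2 ⟨η + (b - c), ?_, by abel⟩), rfl⟩
    rw [hK] at *
    exact H.add_mem hη hbc
  have hdisj : Disjoint (j • A + K) (((K + A) \ K.image (· + c)).image (y - ·)) := by
    rw [Finset.disjoint_left]
    intro p hp hq
    obtain ⟨z, hz, rfl⟩ := mem_image.1 hq
    obtain ⟨η, hη, b, hb, hbc, rfl⟩ := hDmem z hz
    refine hyA (hfull b hb hbc y ?_)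
    obtain ⟨s, hs, k, hk, h⟩ := mem_add.1 hp
    refine mem_add.2 ⟨s, hs, k + η, ?_, ?_⟩
    · rw [hK] at *
      exact H.add_mem hk hη
    · rw [← add_assoc, h]; abel
  have hlarge : (j + 1) * δ + #K ≤ #((j + 1) • A + K) := by
    by_cases hu : (j + 1) • A + K = univ
    · rw [hu, card_univ]
      have h1 := card_le_univ ((j • A + K) ∪ (((K + A) \ K.image (· + c)).image (y - ·)))
      rw [card_union_of_disjoint hdisj, card_image_of_injective _ sub_right_injective,
        hDcard] at h1
      by_cases hju : j • A + K = univ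
      · rw [hju, card_univ] at h1
        have h2 : δ = 0 := by omega
        rw [h2, mul_zero, zero_add]
        exact card_le_univ K
      · have := hchain j hju
        linarith
    · exact hchain _ hu
  set F := {a ∈ A | a - c ∈ K} with hF
  have hFmem : ∀ i : ℕ, ∀ s ∈ i • F, s - i • c ∈ K := by
    intro i
    induction i with
    | zero => intro s hs; simpa using (by simpa using hs : s = 0) ▸ h0K
    | succ i ih =>
      intro s hs
      rw [succ_nsmul] at hs
      obtain ⟨t, ht, a, ha, rfl⟩ := mem_add.1 hs
      have h1 := ih t ht
      have h2 := (mem_filter.1 ha).2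
      rw [hK] at *
      have : t + a - (i + 1) • c = (t - i • c) + (a - c) := by rw [succ_nsmul]; abel
      rw [this]
      exact H.add_mem h1 h2
  have hsplit : #((j + 1) • A + K) - #K + #((j + 1) • F) ≤ #((j + 1) • A) := by
    have hd : Disjoint (((j + 1) • A + K) \ K.image (· + (j + 1) • c)) ((j + 1) • F) := by
      rw [Finset.disjoint_left]
      intro p hp hq
      exact (mem_sdiff.1 hp).2 (mem_image.2 ⟨_, hFmem _ p hq, by abel⟩)
    have hs : (((j + 1) • A + K) \ K.image (· + (j + 1) • c)) ∪ ((j + 1) • F) ⊆ (j + 1) • A := by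
      refine union_subset (fun z hz => ?_) (nsmul_subset_nsmul_left (filter_subset _ _))
      rw [mem_sdiff] at hz
      obtain ⟨s, hs, η, hη, rfl⟩ := mem_add.1 hz.1
      rcases mem_nsmul_cases (H := H) A c j hs with h1 | ⟨b, hb, hbc, hsb⟩
      · exfalso
        refine hz.2 (mem_image.2 ⟨(s - (j + 1) • c) + η, ?_, by abel⟩)
        rw [hK] at *
        exact H.add_mem h1 hη
      · refine hfull b hb (by rwa [hK]) _ (mem_add.2 ⟨s - b, hsb, η, hη, by abel⟩)
    have h1 := card_le_card hs
    rw [card_union_of_disjoint hd] at h1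
    have h2 := le_card_sdiff (K.image (· + (j + 1) • c)) ((j + 1) • A + K)
    rw [card_image_of_injective _ (add_left_injective _)] at h2
    omega
  have hAF : #A ≤ #F + δ := by
    have hs : A ⊆ F ∪ ((K + A) \ K.image (· + c)) := by
      intro a ha
      by_cases h1 : a - c ∈ K
      · exact mem_union_left _ (mem_filter.2 ⟨ha, h1⟩)
      refine mem_union_right _ (mem_sdiff.2 ⟨mem_add.2 ⟨0, h0K, a, ha, zero_add a⟩, ?_⟩)
      rw [mem_image]
      rintro ⟨k, hk, rfl⟩
      exact h1 (by simpa using hk)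
    have := (card_le_card hs).trans (card_union_le _ _)
    omega
  set B : Finset H := {x : H | (x : G) + c ∈ A} with hB
  have hBF : #F ≤ #B := by
    have hs : F ⊆ B.image fun x : H => (x : G) + c := by
      intro a ha
      rw [mem_filter, hK] at ha
      exact mem_image.2 ⟨⟨a - c, ha.2⟩, by simp [hB, ha.1], by simp⟩
    exact (card_le_card hs).trans card_image_le
  have hBmem : ∀ i : ℕ, ∀ x ∈ i • B, (x : G) + i • c ∈ i • F := by
    intro i
    induction i with
    | zero => intro x hx; simpa using hx
    | succ i ih =>
      intro x hx
      rw [succ_nsmul] at hx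
      obtain ⟨t, ht, a, ha, rfl⟩ := mem_add.1 hx
      rw [succ_nsmul]
      refine mem_add.2 ⟨_, ih t ht, (a : G) + c, mem_filter.2 ⟨by simpa [hB] using ha, ?_⟩, ?_⟩
      · rw [hK]; simp
      · rw [succ_nsmul, AddSubgroup.coe_add]; abel
  have hBcard : #((j + 1) • B) ≤ #((j + 1) • F) :=
    card_le_card_of_injOn (fun x : H => (x : G) + (j + 1) • c) (fun x hx => hBmem _ x hx)
      (fun x _ x' _ h => by simpa using h)
  have hKlt : #K < N := by
    rw [← hN]
    refine lt_of_le_of_ne (card_le_univ K) fun h => hKA ?_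
    refine eq_univ_of_card _ (le_antisymm (card_le_univ _) ?_)
    rw [← h]
    exact card_le_card_add_right hA
  obtain ⟨d, q, hd, hdK, hq, hqB⟩ := IH #K hKlt hKcard (A := B)
    ⟨0, by simp [hB, hc]⟩ hj
  obtain ⟨e, rfl⟩ := hdK.trans hdvd
  refine ⟨d, q + e, hd, hdK.trans hKN, ?_, ?_⟩
  · linarith
  · have : #K ≤ #((j + 1) • A + K) := by omega
    have h2 : (j + 1) * (d * e) + #((j + 1) • F) ≤ #((j + 1) • A) := by omega
    linarith

theorem nsmul_subset_foldSumset {G : Type*} [AddCommGroup G] [DecidableEq G] (A : Finset G)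
    (h : ℕ) : ((h • A : Finset G) : Set G) ⊆ foldSumset h A := by
  induction h with
  | zero =>
    intro x hx
    have hx0 : x = 0 := by simpa using hx
    exact ⟨0, by simp, by simp [hx0]⟩
  | succ h ih =>
    intro x hx
    rw [mem_coe, succ_nsmul] at hx
    obtain ⟨s, hs, a, ha, rfl⟩ := mem_add.1 hx
    obtain ⟨c, hc, rfl⟩ := ih hs
    refine ⟨c + Pi.single a 1, ?_, ?_⟩
    · simp [sum_add_distrib, hc, Pi.single_apply, ha]
    · simp [sum_add_distrib, add_smul, Pi.single_apply, ha]

theorem foldSumset_subset_foldSignedSumset {G : Type*} [AddCommGroup G] (h : ℕ) (A : Finset G) :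
    foldSumset h A ⊆ foldSignedSumset h A := by
  rintro x ⟨c, hc, rfl⟩
  exact ⟨fun a => c a, by simpa using hc, by simp⟩

theorem signed_sum_progression {G : Type*} [AddCommGroup G] {q : ℕ} {u v w : G}
    (huv : 2 • u + q • v = 0) (A : Finset G)
    (hA : ∀ a ∈ A, ∃ j ≤ q, ∃ i : ℤ, a = u + j • v + i • w) (c : G → ℤ) :
    ∃ j ≤ (∑ a ∈ A, (c a).natAbs) * q, ∃ i : ℤ,
      ∑ a ∈ A, c a • a = (∑ a ∈ A, (c a).natAbs) • u + j • v + i • w := by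
  classical
  induction A using Finset.induction_on with
  | empty => exact ⟨0, by simp, 0, by simp⟩
  | insert a A ha ih =>
    obtain ⟨j, hj, i, hi⟩ := ih fun b hb => hA b (mem_insert_of_mem hb)
    obtain ⟨k, hk, l, hl⟩ := hA a (mem_insert_self a A)
    rw [sum_insert ha, sum_insert ha, hi]
    rcases Int.natAbs_eq (c a) with hc | hc
    · refine ⟨(c a).natAbs * k + j, ?_, c a * l + i, ?_⟩
      · rw [add_mul]; gcongr
      · generalize (c a).natAbs = r at *
        rw [hc]
        nth_rewrite 1 [hl]
        module
    · obtain ⟨p, rfl⟩ := Nat.exists_eq_add_of_le hk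
      refine ⟨(c a).natAbs * p + j, ?_, c a * l + i, ?_⟩
      · rw [add_mul]; gcongr; omega
      · generalize (c a).natAbs = r at *
        rw [hc]
        nth_rewrite 1 [hl]
        have : (r : ℤ) • (2 • u + (k + p) • v) = 0 := by rw [huv, smul_zero]
        rw [← sub_eq_zero, ← neg_eq_zero, ← this]
        module

theorem exists_card_foldSignedSumset_le_of_gap {d N q m : ℕ} (hd : 0 < d) (hN : 0 < N) {g : ℕ}
    (hg : 0 < g) {u : ℤ} (hu : 2 * u + q * g = 0) (hgap : g * q < N) (hm : m ≤ (q + 1) * d)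
    (h : ℕ) :
    ∃ A : Finset (ZMod (N * d)), #A = m ∧ (foldSignedSumset h A).ncard ≤ (h * q + 1) * d := by
  set K : Finset (ZMod (N * d)) := (range (q + 1) ×ˢ range d).image
    fun p => ((u + p.1 * g + p.2 * N : ℤ) : ZMod (N * d)) with hK
  have hKcard : #K = (q + 1) * d := by
    rw [hK, card_image_of_injOn, card_product, card_range, card_range]
    rintro ⟨j, i⟩ hji ⟨j', i'⟩ hji' heq
    simp only [coe_product, Set.mem_prod, mem_coe, mem_range] at hji hji' heq
    rw [ZMod.intCast_eq_intCast_iff_dvd_sub] at heq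
    push_cast at heq
    have hj : (j : ℤ) = j' := by
      have h1 : (N : ℤ) ∣ ((j' : ℤ) - j) * g := by
        have h2 := (Dvd.intro _ rfl : (N : ℤ) ∣ N * d).trans heq
        have h3 : ((j' : ℤ) - j) * g = (u + j' * g + i' * N - (u + j * g + i * N)) -
          N * (i' - i) := by ring
        rw [h3]
        exact dvd_sub h2 (Dvd.intro _ rfl)
      have h4 : |((j' : ℤ) - j) * g| < N := by
        rw [abs_mul, Nat.abs_cast]
        have h5 : |(j' : ℤ) - j| ≤ q := by rw [abs_le]; omega
        calc |(j' : ℤ) - j| * g ≤ q * g := by gcongr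
          _ < N := by rw [mul_comm]; exact_mod_cast hgap
      have h6 := Int.eq_zero_of_abs_lt_dvd h1 h4
      rcases mul_eq_zero.1 h6 with h7 | h7 <;> omega
    have hi : (i : ℤ) = i' := by
      rw [hj] at heq
      have h1 : (u + (j' : ℤ) * g + i' * N - (u + j' * g + i * N)) = N * ((i' : ℤ) - i) := by ring
      rw [h1] at heq
      have h2 : (d : ℤ) ∣ (i' : ℤ) - i := Int.dvd_of_mul_dvd_mul_left (by omega) heq
      have h3 := Int.eq_zero_of_abs_lt_dvd h2 (by rw [abs_lt]; omega)
      omega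
    ext <;> simp only <;> omega
  obtain ⟨A, hAK, hA⟩ := exists_subset_card_eq (hKcard ▸ hm)
  refine ⟨A, hA, ?_⟩
  set L : Finset (ZMod (N * d)) := (range (h * q + 1) ×ˢ range d).image
    fun p => h • (u : ZMod (N * d)) + p.1 • (g : ZMod (N * d)) + p.2 • (N : ZMod (N * d)) with hL
  have hsub : foldSignedSumset h A ⊆ L := by
    rintro x ⟨c, hc, rfl⟩
    obtain ⟨j, hj, i, hi⟩ := signed_sum_progression (q := q) (u := (u : ZMod (N * d)))
      (v := (g : ZMod (N * d))) (w := (N : ZMod (N * d)))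
      (by
        have := congrArg (Int.cast : ℤ → ZMod (N * d)) hu
        push_cast at this
        simpa using this) A
      (by
        intro a ha
        obtain ⟨⟨j, i⟩, hji, rfl⟩ := mem_image.1 (hAK ha)
        rw [mem_product, mem_range] at hji
        exact ⟨j, Nat.lt_succ_iff.1 hji.1, i, by simp⟩) c
    rw [hc] at hj hi
    rw [hi, mem_coe, hL, mem_image]
    refine ⟨(j, (i % d).toNat), ?_, ?_⟩
    · have h1 := Int.emod_nonneg i (by omega : (d : ℤ) ≠ 0)
      have h2 := Int.emod_lt_of_pos i (by omega : (0 : ℤ) < d)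
      simp only [mem_product, mem_range]
      omega
    · have h1 := Int.emod_nonneg i (by omega : (d : ℤ) ≠ 0)
      congr 1
      rw [← natCast_zsmul, Int.toNat_of_nonneg h1]
      have h2 : (i / d) • ((d : ℤ) • (N : ZMod (N * d))) = 0 := by
        have : ((d : ℤ) • (N : ZMod (N * d))) = ((N * d : ℕ) : ZMod (N * d)) := by
          simp [mul_comm]
        rw [this, ZMod.natCast_self, smul_zero]
      conv_rhs => rw [← Int.emod_add_mul_ediv i d, add_smul, mul_comm (d : ℤ) (i / d), mul_smul, h2, add_zero]
  calc (foldSignedSumset h A).ncard ≤ (L : Set (ZMod (N * d))).ncard :=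
        Set.ncard_le_ncard hsub L.finite_toSet
    _ = #L := Set.ncard_coe_finset L
    _ ≤ (h * q + 1) * d := by
        refine card_image_le.trans ?_
        rw [card_product, card_range, card_range]

theorem ncard_foldSignedSumset_le {n : ℕ} (hn : 0 < n) (h : ℕ) (A : Finset (ZMod n)) :
    (foldSignedSumset h A).ncard ≤ n := by
  have : NeZero n := ⟨hn.ne'⟩
  calc _ ≤ (Set.univ : Set (ZMod n)).ncard := Set.ncard_le_ncard (Set.subset_univ _)
    _ = n := by rw [Set.ncard_univ, Nat.card_zmod]

theorem exists_finset_card {n m : ℕ} (hn : 0 < n) (hm : m ≤ n) :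
    ∃ A : Finset (ZMod n), #A = m := by
  have : NeZero n := ⟨hn.ne'⟩
  obtain ⟨A, -, hA⟩ := exists_subset_card_eq (s := (univ : Finset (ZMod n))) (n := m)
    (by rwa [card_univ, ZMod.card])
  exact ⟨A, hA⟩

theorem exists_card_foldSignedSumset_le {n m h d q : ℕ} (hn : 0 < n) (hmn : m ≤ n) (hh : 2 ≤ h)
    (hd : d ∣ n) (hm : m ≤ (q + 1) * d) :
    ∃ A : Finset (ZMod n), #A = m ∧ (foldSignedSumset h A).ncard ≤ (h * q + 1) * d := by
  obtain ⟨N, rfl⟩ := hd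
  have hd0 : 0 < d := Nat.pos_of_mul_pos_right hn
  have hN0 : 0 < N := Nat.pos_of_mul_pos_left hn
  by_cases hlarge : N ≤ 2 * q
  · obtain ⟨A, hA⟩ := exists_finset_card hn hmn
    refine ⟨A, hA, (ncard_foldSignedSumset_le hn h A).trans ?_⟩
    have : N ≤ h * q + 1 := by nlinarith
    rw [mul_comm]
    gcongr
  rw [mul_comm d N]
  exact exists_card_foldSignedSumset_le_of_gap hd0 hN0 two_pos (u := -q) (by push_cast; ring)
    (by omega) hm h

theorem exists_card_foldSignedSumset_one_le {n m : ℕ} (hn : 0 < n) (hmn : m ≤ n) :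
    ∃ A : Finset (ZMod n), #A = m ∧ (foldSignedSumset 1 A).ncard ≤ m := by
  have : NeZero n := ⟨hn.ne'⟩
  suffices hs : ∃ A : Finset (ZMod n), #A = m ∧ ∀ a ∈ A, -a ∈ A by
    obtain ⟨A, hA, hneg⟩ := hs
    refine ⟨A, hA, ?_⟩
    rw [← hA, ← Set.ncard_coe_finset A]
    refine Set.ncard_le_ncard ?_ A.finite_toSet
    rintro x ⟨c, hc, rfl⟩
    obtain ⟨a, ha, hca, hc0⟩ : ∃ a ∈ A, (c a).natAbs = 1 ∧ ∀ b ∈ A, b ≠ a → c b = 0 := by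
      have hne : ∃ a ∈ A, (c a).natAbs ≠ 0 := by
        by_contra! hall
        rw [sum_eq_zero hall] at hc
        omega
      obtain ⟨a, ha, hca⟩ := hne
      rw [← add_sum_erase A _ ha] at hc
      have h0 : ∑ b ∈ A.erase a, (c b).natAbs = 0 := by omega
      refine ⟨a, ha, by omega, fun b hb hba => ?_⟩
      exact Int.natAbs_eq_zero.1 (sum_eq_zero_iff.1 h0 b (mem_erase.2 ⟨hba, hb⟩))
    rw [mem_coe, sum_eq_single_of_mem a ha fun b hb hba => by rw [hc0 b hb hba, zero_smul]]
    rcases Int.natAbs_eq_iff.1 hca with h1 | h1 <;> rw [h1]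
    · simpa using ha
    · simpa using hneg a ha
  by_cases hmn' : m = n
  · exact ⟨univ, by rw [card_univ, ZMod.card, hmn'], by simp⟩
  have key : ∀ T : Finset ℤ, (∀ t ∈ T, -t ∈ T) → (∀ t ∈ T, 2 * |t| < n) →
      ∃ A : Finset (ZMod n), #A = #T ∧ ∀ a ∈ A, -a ∈ A := by
    intro T hT hlt
    refine ⟨T.image (Int.cast), card_image_of_injOn ?_, ?_⟩
    · intro s hs t ht hst
      rw [ZMod.intCast_eq_intCast_iff_dvd_sub] at hst
      have h1 := hlt s hs
      have h2 := hlt t ht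
      have := Int.eq_zero_of_abs_lt_dvd hst (by
        have := abs_sub t s
        omega)
      omega
    · intro a ha
      obtain ⟨t, ht, rfl⟩ := mem_image.1 ha
      exact mem_image.2 ⟨-t, hT t ht, by simp⟩
  obtain ⟨r, hr | hr⟩ := Nat.even_or_odd' m
  · obtain ⟨A, hA, h1⟩ := key ((Icc (-r : ℤ) r).erase 0)
      (by intro t; simp only [mem_erase, mem_Icc]; omega)
      (by
        intro t
        simp only [mem_erase, mem_Icc]
        intro ht
        have : |t| ≤ r := abs_le.2 ht.2
        omega)
    refine ⟨A, ?_, h1⟩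
    rw [hA, card_erase_of_mem (by simp), Int.card_Icc]
    omega
  · obtain ⟨A, hA, h1⟩ := key (Icc (-r : ℤ) r)
      (by intro t; simp only [mem_Icc]; omega)
      (by
        intro t
        simp only [mem_Icc]
        intro ht
        have : |t| ≤ r := abs_le.2 ht
        omega)
    refine ⟨A, ?_, h1⟩
    rw [hA, Int.card_Icc]
    omega

theorem exists_foldSignedSumset_ncard_le_foldSumset {n m h : ℕ} (hn : 0 < n) (hm : 0 < m)
    (hh : 0 < h) (hmn : m ≤ n) (A : Finset (ZMod n)) (hA : #A = m) :
    ∃ B : Finset (ZMod n), #B = m ∧ (foldSignedSumset h B).ncard ≤ (foldSumset h A).ncard := by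
  have : NeZero n := ⟨hn.ne'⟩
  have hle : #(h • A) ≤ (foldSumset h A).ncard := by
    rw [← Set.ncard_coe_finset]
    exact Set.ncard_le_ncard (nsmul_subset_foldSumset A h)
  obtain rfl | hh2 : h = 1 ∨ 2 ≤ h := by omega
  · obtain ⟨B, hB, hle'⟩ := exists_card_foldSignedSumset_one_le hn hmn
    rw [one_nsmul, hA] at hle
    exact ⟨B, hB, hle'.trans hle⟩
  obtain ⟨j, rfl⟩ := Nat.exists_eq_add_of_le' hh
  obtain ⟨d, q, -, hdn, hq, hqA⟩ := exists_dvd_card_nsmul_ge n (ZMod.card n)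
    (card_pos.1 (hA ▸ hm)) (j := j) (by omega)
  obtain ⟨B, hB, hle'⟩ := exists_card_foldSignedSumset_le hn hmn hh2 hdn (hA ▸ hq)
  exact ⟨B, hB, hle'.trans (hqA.trans hle)⟩

/-- for cyclic groups, `ρ±(ℤ_n, m, h) = ρ(ℤ_n, m, h)`. -/
theorem rhoPM_eq_rho_cyclic (n m h : ℕ) (hn : 0 < n) (hm : 0 < m) (hh : 0 < h)
    (hmn : m ≤ n) :
    rhoPM (ZMod n) m h = rho (ZMod n) m h := by
  have : NeZero n := ⟨hn.ne'⟩
  obtain ⟨A₀, hA₀⟩ := exists_finset_card hn hmn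
  apply le_antisymm
  · obtain ⟨A, hA, hAk⟩ := Nat.sInf_mem (s := {k | ∃ A : Finset (ZMod n), A.card = m ∧
      (foldSumset h A).ncard = k}) ⟨_, A₀, hA₀, rfl⟩
    obtain ⟨B, hB, hle⟩ := exists_foldSignedSumset_ncard_le_foldSumset hn hm hh hmn A hA
    have h1 : rhoPM (ZMod n) m h ≤ (foldSignedSumset h B).ncard := Nat.sInf_le ⟨B, hB, rfl⟩
    exact h1.trans (hle.trans hAk.le)
  · obtain ⟨A, hA, hAk⟩ := Nat.sInf_mem (s := {k | ∃ A : Finset (ZMod n), A.card = m ∧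
      (foldSignedSumset h A).ncard = k}) ⟨_, A₀, hA₀, rfl⟩
    have h1 : rho (ZMod n) m h ≤ (foldSumset h A).ncard := Nat.sInf_le ⟨A, hA, rfl⟩
    have h2 := Set.ncard_le_ncard (foldSumset_subset_foldSignedSumset h A)
    exact h1.trans (h2.trans hAk.le)
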